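/- Suppose that for all v, w ∈ ℋ the matrix coefficient g ↦ ⟪π(g)v, w⟫ tends to 0 along the cocompact filter of G (matrix coefficients vanish at infinity). Then G acts properly on ℋ ∖ {0}: for every compact subset C ⊆ ℋ with 0 ∉ C, the set C_G = {g ∈ G : π(g)(C) ∩ C ≠ ∅} is a compact subset of G. -/

import Mathlib

open Filter Topology in
/-- If the matrix coefficient of `v₀` and `w₀` along a family of isometries tends to `0`, then so
do the matrix coefficients of nearby vectors, jointly. -/
theorem tendsto_inner_prod_nhds_of_isometries {α H : Type*} [NormedAddCommGroup H]
    [InnerProductSpace ℂ H] {l : Filter α} {T : α → H →L[ℂ] H}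
    (hT : ∀ a v, ‖T a v‖ = ‖v‖) {v₀ w₀ : H}
    (h : Tendsto (fun a => (inner ℂ (T a v₀) w₀ : ℂ)) l (𝓝 0)) :
    Tendsto (fun p : α × H × H => (inner ℂ (T p.1 p.2.1) p.2.2 : ℂ))
      (l ×ˢ 𝓝 (v₀, w₀)) (𝓝 0) := by
  have hbound : Tendsto (fun p : α × H × H => ‖(inner ℂ (T p.1 v₀) w₀ : ℂ)‖ +
      (‖p.2.1 - v₀‖ * ‖p.2.2‖ + ‖v₀‖ * ‖p.2.2 - w₀‖)) (l ×ˢ 𝓝 (v₀, w₀)) (𝓝 0) := by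
    have h₁ : Tendsto (fun p : α × H × H => ‖(inner ℂ (T p.1 v₀) w₀ : ℂ)‖)
        (l ×ˢ 𝓝 (v₀, w₀)) (𝓝 0) := by
      simpa using (h.comp (tendsto_fst (g := 𝓝 (v₀, w₀)))).norm
    have h₂ : Tendsto (fun q : H × H => ‖q.1 - v₀‖ * ‖q.2‖ + ‖v₀‖ * ‖q.2 - w₀‖)
        (𝓝 (v₀, w₀)) (𝓝 0) :=
      Continuous.tendsto' (by fun_prop) _ _ (by simp)
    simpa using h₁.add (h₂.comp (tendsto_snd (f := l)))
  refine squeeze_zero_norm (fun p => ?_) hbound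
  obtain ⟨a, v, w⟩ := p
  have hsplit : (inner ℂ (T a v) w : ℂ) =
      inner ℂ (T a v₀) w₀ + (inner ℂ (T a (v - v₀)) w + inner ℂ (T a v₀) (w - w₀)) := by
    simp only [map_sub, inner_sub_left, inner_sub_right]
    ring
  have h₁ := norm_inner_le_norm (𝕜 := ℂ) (T a (v - v₀)) w
  have h₂ := norm_inner_le_norm (𝕜 := ℂ) (T a v₀) (w - w₀)
  rw [hT] at h₁ h₂
  rw [hsplit]
  exact (norm_add_le _ _).trans
    (add_le_add le_rfl ((norm_add_le _ _).trans (add_le_add h₁ h₂)))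

open Filter Topology in
/-- A family of isometries whose matrix coefficients tend to `0` eventually moves a compact set
not containing `0` off itself. -/
theorem eventually_forall_notMem_of_tendsto_inner {α H : Type*} [NormedAddCommGroup H]
    [InnerProductSpace ℂ H] {l : Filter α} {T : α → H →L[ℂ] H}
    (hT : ∀ a v, ‖T a v‖ = ‖v‖)
    (h : ∀ v w, Tendsto (fun a => (inner ℂ (T a v) w : ℂ)) l (𝓝 0))
    {C : Set H} (hC : IsCompact C) (h0 : (0 : H) ∉ C) :
    ∀ᶠ a in l, ∀ v ∈ C, T a v ∉ C := by
  have hne : ∀ᶠ a in l, ∀ q ∈ C ×ˢ C, T a q.1 ≠ q.2 := by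
    refine (hC.prod hC).induction_on (p := fun s => ∀ᶠ a in l, ∀ q ∈ s, T a q.1 ≠ q.2)
      (by simp) (fun s t hst ht => ht.mono fun a ha q hq => ha q (hst hq))
      (fun s t hs ht => ?_) ?_
    · filter_upwards [hs, ht] with a has hat q hq
      exact hq.elim (has q) (hat q)
    · rintro ⟨v₀, w₀⟩ ⟨-, hw₀⟩
      have hw : (inner ℂ w₀ w₀ : ℂ) ≠ 0 :=
        inner_self_ne_zero.2 fun hz => h0 (hz ▸ hw₀)
      have hself : Tendsto (fun q : H × H => (inner ℂ q.2 q.2 : ℂ))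
          (𝓝 (v₀, w₀)) (𝓝 (inner ℂ w₀ w₀)) :=
        Continuous.tendsto' (by fun_prop) _ _ rfl
      have hev : ∀ᶠ p : α × H × H in l ×ˢ 𝓝 (v₀, w₀), T p.1 p.2.1 ≠ p.2.2 := by
        filter_upwards [((hself.comp (tendsto_snd (f := l))).sub
          (tendsto_inner_prod_nhds_of_isometries hT (h v₀ w₀))).eventually_ne (b₂ := 0)
          (by rwa [sub_zero])] with p hp heq
        exact hp (by simp [heq])
      obtain ⟨P, hP, Q, hQ, hPQ⟩ := eventually_prod_iff.1 hev
      exact ⟨{q | Q q}, mem_nhdsWithin_of_mem_nhds hQ, hP.mono fun a ha q hq => hPQ ha hq⟩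
  filter_upwards [hne] with a ha v hv hav
  exact ha (v, T a v) ⟨hv, hav⟩ rfl

/-- For a continuous map `f : X × Y → Z`, the set of `x` such that `f (x, ·)` sends some point of
a compact set into a given closed set is closed. -/
theorem IsCompact.isClosed_setOf_exists_mem {X Y Z : Type*} [TopologicalSpace X]
    [TopologicalSpace Y] [TopologicalSpace Z] {f : X × Y → Z} (hf : Continuous f)
    {K : Set Y} (hK : IsCompact K) {D : Set Z} (hD : IsClosed D) :
    IsClosed {x | ∃ y ∈ K, f (x, y) ∈ D} := by
  have := isCompact_iff_compactSpace.1 hK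
  have hclosed : IsClosed {p : X × K | f (p.1, p.2) ∈ D} :=
    hD.preimage (by fun_prop)
  convert isClosedMap_fst_of_compactSpace _ hclosed using 1
  ext x
  simp


/-- let `G` be a locally compact, second-countable Hausdorff topological
group and `(π, ℋ)` a unitary representation of `G` (with continuous action map).
If all matrix coefficients `g ↦ ⟪π(g)v, w⟫` vanish at infinity (tend to `0` along the
cocompact filter of `G`), then `G` acts properly on `ℋ ∖ {0}`: for every compact
`C ⊆ ℋ` with `0 ∉ C` the set `C_G = {g : π(g)C ∩ C ≠ ∅}` is compact. -/
theorem stmt_10 {G : Type*} [Group G] [TopologicalSpace G] [IsTopologicalGroup G]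
    [LocallyCompactSpace G] [SecondCountableTopology G] [T2Space G]
    {H : Type*} [NormedAddCommGroup H] [InnerProductSpace ℂ H] [CompleteSpace H]
    (π : G →* unitary (H →L[ℂ] H))
    (hcont : Continuous fun p : G × H => (π p.1 : H →L[ℂ] H) p.2)
    (hvanish : ∀ v w : H,
      Filter.Tendsto (fun g : G => (inner ℂ ((π g : H →L[ℂ] H) v) w : ℂ))
        (Filter.cocompact G) (nhds 0)) :
    ∀ C : Set H, IsCompact C → (0 : H) ∉ C →
      IsCompact {g : G | ∃ v ∈ C, (π g : H →L[ℂ] H) v ∈ C} := by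
  intro C hC h0
  have hev := eventually_forall_notMem_of_tendsto_inner (T := fun g => (π g : H →L[ℂ] H))
    (fun g v => ContinuousLinearMap.norm_map_of_mem_unitary (π g).2 v) hvanish hC h0
  obtain ⟨K, hK, hsub⟩ := Filter.mem_cocompact.1 hev
  refine hK.of_isClosed_subset (hC.isClosed_setOf_exists_mem hcont hC.isClosed) ?_
  rintro g ⟨v, hv, hgv⟩
  by_contra hg
  exact hsub hg v hv hgv
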